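/- Let β ∈ C([0,∞)) be increasing with β(0) = 0 and γ(r) := ½ ∫₀^r ds/√β(s) < ∞ for every r > 0. Suppose the β-log-Sobolev inequality holds: β( μ(g² log g²) ) ≤ μ(|∇g|²) for all g ∈ C¹_b(ℝⁿ) with μ(g²) = 1. Then the transportation-entropy inequality W₂(fμ, μ) ≤ γ( μ(f log f) ) holds for every probability density f ≥ 0 with μ(f) = 1. -/

import Mathlib

open MeasureTheory ENNReal NNReal Classical

/-- A coupling of `ν` and `μ`. -/
def IsCoupling {n : ℕ}
    (π : Measure (EuclideanSpace ℝ (Fin n) × EuclideanSpace ℝ (Fin n)))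
    (ν μ : Measure (EuclideanSpace ℝ (Fin n))) : Prop :=
  π.map Prod.fst = ν ∧ π.map Prod.snd = μ

/-- The `L^p`-Wasserstein distance for the Euclidean distance. -/
noncomputable def wassersteinDist {n : ℕ} (p : ℝ)
    (ν μ : Measure (EuclideanSpace ℝ (Fin n))) : ℝ≥0∞ :=
  (⨅ (π : Measure (EuclideanSpace ℝ (Fin n) × EuclideanSpace ℝ (Fin n)))
      (_ : IsCoupling π ν μ), ∫⁻ q, edist q.1 q.2 ^ p ∂π) ^ (1 / p)

/-- The relative entropy (Kullback information) `H(ν|μ)`. -/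
noncomputable def relEntropy {n : ℕ}
    (ν μ : Measure (EuclideanSpace ℝ (Fin n))) : ℝ≥0∞ :=
  if ν ≪ μ ∧ Integrable (llr ν μ) ν then ENNReal.ofReal (∫ x, llr ν μ x ∂ν) else ⊤

/-- The Fisher information `I(ν|μ) = ∫ |∇√f|² dμ` for `ν = fμ` with `√f ∈ H¹(μ)`,
and `+∞` otherwise. -/
noncomputable def fisherInfo {n : ℕ}
    (ν μ : Measure (EuclideanSpace ℝ (Fin n))) : ℝ≥0∞ :=
  ⨅ (f : EuclideanSpace ℝ (Fin n) → ℝ) (_ : ∀ x, 0 ≤ f x)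
    (_ : ν = μ.withDensity fun x => ENNReal.ofReal (f x))
    (_ : Differentiable ℝ fun x => Real.sqrt (f x)),
    ∫⁻ x, (‖gradient (fun y => Real.sqrt (f y)) x‖₊ : ℝ≥0∞) ^ 2 ∂μ

section Kantorovich

open Filter Topology BoundedContinuousFunction

variable {E : Type*} [NormedAddCommGroup E] [MeasurableSpace E] [BorelSpace E]

/-- A positive linear functional on bounded continuous functions on `E × E` with prescribed
marginals and cost at most `D`, obtained from the dual Kantorovich bound by Hahn-Banach. -/
theorem exists_functional_of_dual_bound (ν μ : Measure E) [IsProbabilityMeasure ν]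
    [IsProbabilityMeasure μ] (c : E × E → ℝ) (D : ℝ)
    (hD : ∀ φ ψ : E →ᵇ ℝ, (∀ q : E × E, φ q.1 + ψ q.2 ≤ c q) →
      ∫ x, φ x ∂ν + ∫ x, ψ x ∂μ ≤ D) :
    ∃ L : (E × E →ᵇ ℝ) →ₗ[ℝ] ℝ, (∀ w, (∀ q, 0 ≤ w q) → 0 ≤ L w) ∧
      (∀ φ : E →ᵇ ℝ, L (φ.compContinuous ⟨Prod.fst, continuous_fst⟩) = ∫ x, φ x ∂ν) ∧
      (∀ φ : E →ᵇ ℝ, L (φ.compContinuous ⟨Prod.snd, continuous_snd⟩) = ∫ x, φ x ∂μ) ∧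
      ∀ w, (∀ q, w q ≤ c q) → L w ≤ D := by
  have hint : ∀ (ρ : Measure E) [IsProbabilityMeasure ρ] (φ : E →ᵇ ℝ), Integrable φ ρ :=
    fun ρ _ φ => φ.integrable ρ
  set S : (E × E →ᵇ ℝ) → Set ℝ := fun w => {r | ∃ φ ψ : E →ᵇ ℝ, ∃ s : ℝ, 0 ≤ s ∧
    (∀ q : E × E, w q ≤ φ q.1 + ψ q.2 + s * c q) ∧
    r = ∫ x, φ x ∂ν + ∫ x, ψ x ∂μ + s * D} with hS
  have hlb : ∀ w, ∀ r ∈ S w, -‖w‖ ≤ r := by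
    rintro w r ⟨φ, ψ, s, hs, hw, rfl⟩
    have h0 : ∀ q : E × E, 0 ≤ (φ q.1 + ‖w‖) + ψ q.2 + s * c q := fun q => by
      have h1 := hw q
      have h2 := (abs_le.1 (w.norm_coe_le_norm q)).1
      linarith
    have hφ : ∫ x, (φ x + ‖w‖) ∂ν = ∫ x, φ x ∂ν + ‖w‖ := by
      rw [integral_add (hint ν φ) (integrable_const _)]; simp
    rcases hs.eq_or_lt with rfl | hs
    · have h3 : ∀ y, 0 ≤ ∫ x, φ x ∂ν + ‖w‖ + ψ y := fun y => by
        have : 0 ≤ ∫ x, (φ x + ‖w‖ + ψ y) ∂ν :=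
          integral_nonneg fun x => by simpa using h0 (x, y)
        rw [integral_add (f := fun x => φ x + ‖w‖) (g := fun _ => ψ y)
          ((hint ν φ).add (integrable_const _)) (integrable_const _), hφ] at this
        simpa using this
      have : 0 ≤ ∫ y, (∫ x, φ x ∂ν + ‖w‖ + ψ y) ∂μ := integral_nonneg h3
      rw [integral_add (integrable_const _) (hint μ ψ)] at this
      simp at this
      linarith
    · have := hD (-(s⁻¹ • (φ + const E ‖w‖))) (-(s⁻¹ • ψ)) (fun q => by
        have h1 : s⁻¹ * (φ q.1 + ‖w‖ + ψ q.2 + s * c q) =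
          s⁻¹ * (φ q.1 + ‖w‖) + s⁻¹ * ψ q.2 + c q := by field_simp
        have h2 := mul_nonneg (inv_nonneg.2 hs.le) (h0 q)
        simp only [BoundedContinuousFunction.coe_neg, BoundedContinuousFunction.coe_smul,
          BoundedContinuousFunction.coe_add, Pi.neg_apply, Pi.add_apply, const_apply,
          smul_eq_mul]
        linarith)
      simp only [BoundedContinuousFunction.coe_neg, BoundedContinuousFunction.coe_smul,
          BoundedContinuousFunction.coe_add, Pi.neg_apply, Pi.add_apply, const_apply,
          smul_eq_mul, integral_neg, integral_const_mul, hφ] at this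
      have h5 : s * (-(s⁻¹ * (∫ x, φ x ∂ν + ‖w‖)) + -(s⁻¹ * ∫ x, ψ x ∂μ)) ≤ s * D :=
        mul_le_mul_of_nonneg_left this hs.le
      have h6 : s * (-(s⁻¹ * (∫ x, φ x ∂ν + ‖w‖)) + -(s⁻¹ * ∫ x, ψ x ∂μ)) =
        -(∫ x, φ x ∂ν + ‖w‖) - ∫ x, ψ x ∂μ := by field_simp; ring
      linarith
  have hbdd : ∀ w, BddBelow (S w) := fun w => ⟨_, fun r hr => hlb w r hr⟩
  have hne : ∀ w, (S w).Nonempty := fun w =>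
    ⟨_, const E ‖w‖, 0, 0, le_rfl, fun q => by
      simpa using (abs_le.1 (w.norm_coe_le_norm q)).2, rfl⟩
  set p : (E × E →ᵇ ℝ) → ℝ := fun w => sInf (S w) with hp
  have hple : ∀ w, ∀ r ∈ S w, p w ≤ r := fun w r hr => csInf_le (hbdd w) hr
  have hsmul_le : ∀ a : ℝ, 0 < a → ∀ w, p (a • w) ≤ a * p w := fun a ha w => by
    rw [← div_le_iff₀' ha]
    refine le_csInf (hne w) ?_
    rintro r ⟨φ, ψ, s, hs, hw, rfl⟩
    rw [div_le_iff₀' ha]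
    refine hple _ _ ⟨a • φ, a • ψ, a * s, by positivity, fun q => ?_, ?_⟩
    · have := mul_le_mul_of_nonneg_left (hw q) ha.le
      simp only [BoundedContinuousFunction.coe_smul, smul_eq_mul]
      linarith
    · simp only [BoundedContinuousFunction.coe_smul, smul_eq_mul, integral_const_mul]; ring
  have hsmul : ∀ a : ℝ, 0 < a → ∀ w, p (a • w) = a * p w := fun a ha w => by
    refine le_antisymm (hsmul_le a ha w) ?_
    have := hsmul_le a⁻¹ (inv_pos.2 ha) (a • w)
    rw [smul_smul, inv_mul_cancel₀ ha.ne', one_smul] at this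
    rwa [← div_eq_inv_mul, le_div_iff₀' ha] at this
  have hadd : ∀ v w, p (v + w) ≤ p v + p w := fun v w => by
    rw [← sub_le_iff_le_add]
    refine le_csInf (hne v) ?_
    rintro r ⟨φ, ψ, s, hs, hv, rfl⟩
    rw [sub_le_comm]
    refine le_csInf (hne w) ?_
    rintro r ⟨φ', ψ', s', hs', hw, rfl⟩
    rw [sub_le_iff_le_add]
    refine hple _ _ ⟨φ + φ', ψ + ψ', s + s', by positivity, fun q => ?_, ?_⟩
    · have h1 := hv q
      have h2 := hw q
      simp only [BoundedContinuousFunction.coe_add, Pi.add_apply]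
      linarith
    · simp only [BoundedContinuousFunction.coe_add, Pi.add_apply]
      rw [integral_add (hint ν _) (hint ν _), integral_add (hint μ _) (hint μ _)]
      ring
  obtain ⟨L, -, hL⟩ := exists_extension_of_le_sublinear
    (⊥ : (E × E →ᵇ ℝ) →ₗ.[ℝ] ℝ) p hsmul hadd (by
      rintro ⟨x, hx⟩
      have hx0 : x = 0 := (Submodule.mem_bot ℝ).1 hx
      subst hx0
      have h1 : (0 : ℝ) ≤ p 0 := le_csInf (hne 0) fun r hr => by simpa using hlb 0 r hr
      have h2 : ((⊥ : (E × E →ᵇ ℝ) →ₗ.[ℝ] ℝ) ⟨0, hx⟩) = 0 :=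
        LinearPMap.map_zero _
      rw [h2]
      exact h1)
  have hfst : ∀ φ : E →ᵇ ℝ, L (φ.compContinuous ⟨Prod.fst, continuous_fst⟩) ≤ ∫ x, φ x ∂ν :=
    fun φ => (hL _).trans (hple _ _ ⟨φ, 0, 0, le_rfl, fun q => by simp, by simp⟩)
  have hsnd : ∀ φ : E →ᵇ ℝ, L (φ.compContinuous ⟨Prod.snd, continuous_snd⟩) ≤ ∫ x, φ x ∂μ :=
    fun φ => (hL _).trans (hple _ _ ⟨0, φ, 0, le_rfl, fun q => by simp, by simp⟩)
  refine ⟨L, fun w hw => ?_, fun φ => (hfst φ).antisymm ?_, fun φ => (hsnd φ).antisymm ?_,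
    fun w hw => (hL _).trans (hple _ _ ⟨0, 0, 1, zero_le_one, fun q => by simpa using hw q,
      by simp⟩)⟩
  · have := (hL (-w)).trans (hple _ _ ⟨0, 0, 0, le_rfl, fun q => by simpa using hw q, rfl⟩)
    simpa using this
  · have := hfst (-φ)
    have h2 : (-φ).compContinuous ⟨Prod.fst, continuous_fst⟩ =
      -(φ.compContinuous (⟨Prod.fst, continuous_fst⟩ : C(E × E, E))) := by ext; simp
    rw [h2, map_neg] at this
    simp only [BoundedContinuousFunction.coe_neg, Pi.neg_apply, integral_neg] at this
    linarith
  · have := hsnd (-φ)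
    have h2 : (-φ).compContinuous ⟨Prod.snd, continuous_snd⟩ =
      -(φ.compContinuous (⟨Prod.snd, continuous_snd⟩ : C(E × E, E))) := by ext; simp
    rw [h2, map_neg] at this
    simp only [BoundedContinuousFunction.coe_neg, Pi.neg_apply, integral_neg] at this
    linarith

/-- A continuous cutoff function on a normed space, supported in the ball of radius `k + 1`. -/
noncomputable def ballCutoff (E : Type*) [NormedAddCommGroup E] (k : ℕ) : E →ᵇ ℝ :=
  BoundedContinuousFunction.ofNormedAddCommGroup (fun x : E => max 0 (min 1 ((k : ℝ) + 1 - ‖x‖)))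
    (by fun_prop) 1 (fun x => by
      rw [Real.norm_eq_abs, abs_le]
      constructor
      · linarith [le_max_left 0 (min 1 ((k : ℝ) + 1 - ‖x‖))]
      · exact max_le zero_le_one (min_le_left _ _))

theorem ballCutoff_apply {E : Type*} [NormedAddCommGroup E] (k : ℕ) (x : E) :
    ballCutoff E k x = max 0 (min 1 ((k : ℝ) + 1 - ‖x‖)) := rfl

theorem ballCutoff_nonneg {E : Type*} [NormedAddCommGroup E] (k : ℕ) (x : E) :
    0 ≤ ballCutoff E k x := le_max_left _ _

theorem ballCutoff_le_one {E : Type*} [NormedAddCommGroup E] (k : ℕ) (x : E) :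
    ballCutoff E k x ≤ 1 := max_le zero_le_one (min_le_left _ _)

theorem ballCutoff_eq_zero {E : Type*} [NormedAddCommGroup E] {k : ℕ} {x : E}
    (hx : (k : ℝ) + 1 < ‖x‖) : ballCutoff E k x = 0 := by
  rw [ballCutoff_apply]
  exact max_eq_left ((min_le_right _ _).trans (by linarith))

theorem tendsto_ballCutoff {E : Type*} [NormedAddCommGroup E] (x : E) :
    Tendsto (fun k => ballCutoff E k x) atTop (𝓝 1) := by
  refine tendsto_const_nhds.congr' ?_
  filter_upwards [eventually_ge_atTop ⌈‖x‖⌉₊] with k hk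
  have : ‖x‖ ≤ k := Nat.ceil_le.1 hk
  rw [ballCutoff_apply, min_eq_left (by linarith), max_eq_right zero_le_one]

theorem tendsto_integral_one_sub_ballCutoff (ρ : Measure E) [IsProbabilityMeasure ρ] :
    Tendsto (fun k => ∫ x, (1 - ballCutoff E k x) ∂ρ) atTop (𝓝 0) := by
  have := tendsto_integral_of_dominated_convergence (μ := ρ)
    (F := fun k x => 1 - ballCutoff E k x) (f := fun _ => (0 : ℝ)) (fun _ => 1)
    (fun k => (((1 : E →ᵇ ℝ) - ballCutoff E k).integrable ρ).aestronglyMeasurable)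
    (integrable_const _)
    (fun k => ae_of_all _ fun x => by
      rw [Real.norm_eq_abs, abs_le]
      constructor <;> linarith [ballCutoff_nonneg k x, ballCutoff_le_one k x])
    (ae_of_all _ fun x => by simpa using (tendsto_ballCutoff x).const_sub 1)
  simpa using this

/-- **Kantorovich duality** for a nonnegative continuous cost, in the form of the existence of a
coupling whose cost is at most any upper bound of the dual problem. -/
theorem exists_coupling_of_dual_bound [ProperSpace E] (ν μ : Measure E) [IsProbabilityMeasure ν]
    [IsProbabilityMeasure μ] (c : E × E → ℝ) (hc : Continuous c) (hc0 : ∀ q, 0 ≤ c q) (D : ℝ)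
    (hD : ∀ φ ψ : E →ᵇ ℝ, (∀ q : E × E, φ q.1 + ψ q.2 ≤ c q) →
      ∫ x, φ x ∂ν + ∫ x, ψ x ∂μ ≤ D) :
    ∃ π : Measure (E × E), π.map Prod.fst = ν ∧ π.map Prod.snd = μ ∧
      ∫⁻ q, ENNReal.ofReal (c q) ∂π ≤ ENNReal.ofReal D := by
  obtain ⟨L, hpos, hfst, hsnd, hcost⟩ := exists_functional_of_dual_bound ν μ c D hD
  have hmono : ∀ v w : E × E →ᵇ ℝ, (∀ q, v q ≤ w q) → L v ≤ L w := fun v w h => by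
    have := hpos (w - v) fun q => by simpa using h q
    rw [map_sub] at this
    linarith
  let J : CompactlySupportedContinuousMap (E × E) ℝ →ₗ[ℝ] (E × E →ᵇ ℝ) :=
    { toFun := fun f => f.toBoundedContinuousFunction
      map_add' := fun f g => by ext; rfl
      map_smul' := fun a f => by ext; rfl }
  let Λ : CompactlySupportedContinuousMap (E × E) ℝ →ₚ[ℝ] ℝ :=
    PositiveLinearMap.mk₀ (L ∘ₗ J) fun f hf => hpos _ fun q => hf q
  let χ : ℕ → E × E → ℝ := fun k q => ballCutoff E k q.1 * ballCutoff E k q.2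
  have hχc : ∀ k, Continuous (χ k) := fun k => by fun_prop
  have hχ0 : ∀ k q, 0 ≤ χ k q := fun k q =>
    mul_nonneg (ballCutoff_nonneg _ _) (ballCutoff_nonneg _ _)
  have hχ1 : ∀ k q, χ k q ≤ 1 := fun k q =>
    mul_le_one₀ (ballCutoff_le_one _ _) (ballCutoff_nonneg _ _) (ballCutoff_le_one _ _)
  have hχlim : ∀ q, Tendsto (fun k => χ k q) atTop (𝓝 1) := fun q => by
    simpa using (tendsto_ballCutoff q.1).mul (tendsto_ballCutoff q.2)
  have hχs : ∀ k, HasCompactSupport (χ k) := fun k => by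
    refine HasCompactSupport.intro (isCompact_closedBall (0 : E × E) (k + 1)) fun q hq => ?_
    rw [mem_closedBall_zero_iff, Prod.norm_def, not_le, lt_max_iff] at hq
    rcases hq with hq | hq <;> simp [χ, ballCutoff_eq_zero hq]
  have hF : ∀ h : E × E → ℝ, Continuous h → ∀ k,
      ∃ f : CompactlySupportedContinuousMap (E × E) ℝ, ∀ q, f q = χ k q * h q := fun h hh k =>
    ⟨⟨⟨fun q => χ k q * h q, (hχc k).mul hh⟩, (hχs k).mul_right⟩, fun q => rfl⟩
  set π : Measure (E × E) := RealRMK.rieszMeasure Λ with hπ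
  have hrep : ∀ f : CompactlySupportedContinuousMap (E × E) ℝ, ∫ q, f q ∂π = L (J f) :=
    fun f => RealRMK.integral_rieszMeasure Λ f
  have hfatou : ∀ h : E × E → ℝ, Continuous h → (∀ q, 0 ≤ h q) → ∀ A : ℝ,
      (∀ w : E × E →ᵇ ℝ, (∀ q, w q ≤ h q) → L w ≤ A) →
      ∫⁻ q, ENNReal.ofReal (h q) ∂π ≤ ENNReal.ofReal A := by
    intro h hh h0 A hA
    have h1 : ∀ q, ENNReal.ofReal (h q) =
        liminf (fun k => ENNReal.ofReal (χ k q * h q)) atTop := fun q => by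
      refine (Tendsto.liminf_eq ?_).symm
      refine ENNReal.tendsto_ofReal ?_
      simpa using (hχlim q).mul_const (h q)
    simp_rw [h1]
    refine (lintegral_liminf_le fun k => by fun_prop).trans ?_
    refine liminf_le_of_le (by isBoundedDefault) fun b hb => ?_
    obtain ⟨k, hk⟩ := hb.exists
    refine hk.trans ?_
    obtain ⟨f, hf⟩ := hF h hh k
    have h2 : Integrable (fun q => χ k q * h q) π := by
      have := f.continuous.integrable_of_hasCompactSupport (μ := π) f.hasCompactSupport
      exact this.congr (ae_of_all _ hf)
    rw [← ofReal_integral_eq_lintegral_ofReal h2 (ae_of_all _ fun q => mul_nonneg (hχ0 k q) (h0 q))]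
    refine ENNReal.ofReal_le_ofReal ?_
    rw [show ∫ q, χ k q * h q ∂π = ∫ q, f q ∂π by simp_rw [hf], hrep]
    refine hA _ fun q => ?_
    change f q ≤ h q
    rw [hf]
    exact mul_le_of_le_one_left (h0 q) (hχ1 k q)
  have hL1 : L (BoundedContinuousFunction.const _ 1) = 1 := by
    have := hfst (BoundedContinuousFunction.const _ 1)
    rw [show ((BoundedContinuousFunction.const E (1 : ℝ)).compContinuous
      (⟨Prod.fst, continuous_fst⟩ : C(E × E, E))) = BoundedContinuousFunction.const _ 1 by
        ext; simp] at this
    simpa using this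
  have : IsFiniteMeasure π := by
    refine ⟨?_⟩
    have := hfatou (fun _ => 1) continuous_const (fun _ => zero_le_one) 1 fun w hw =>
      (hmono w (BoundedContinuousFunction.const _ 1) (by simpa using hw)).trans hL1.le
    simp only [ENNReal.ofReal_one, lintegral_const, one_mul] at this
    exact this.trans_lt ENNReal.one_lt_top
  have hlim : ∀ w : E × E →ᵇ ℝ, ∫ q, w q ∂π = L w := by
    intro w
    have hA : Tendsto (fun k => ∫ q, χ k q * w q ∂π) atTop (𝓝 (∫ q, w q ∂π)) := by
      refine tendsto_integral_of_dominated_convergence (fun _ => ‖w‖)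
        (fun k => ((hχc k).mul w.continuous).aestronglyMeasurable) (integrable_const _)
        (fun k => ae_of_all _ fun q => ?_)
        (ae_of_all _ fun q => by simpa using (hχlim q).mul_const (w q))
      rw [norm_mul, Real.norm_of_nonneg (hχ0 k q)]
      exact (mul_le_of_le_one_left (norm_nonneg _) (hχ1 k q)).trans (w.norm_coe_le_norm q)
    refine tendsto_nhds_unique hA ?_
    rw [tendsto_iff_norm_sub_tendsto_zero]
    have hB := ((tendsto_integral_one_sub_ballCutoff ν).add
      (tendsto_integral_one_sub_ballCutoff μ)).const_mul ‖w‖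
    rw [add_zero, mul_zero] at hB
    refine squeeze_zero (fun _ => norm_nonneg _) (fun k => ?_) hB
    obtain ⟨f, hf⟩ := hF w w.continuous k
    rw [show ∫ q, χ k q * w q ∂π = ∫ q, f q ∂π by simp_rw [hf], hrep, ← map_sub]
    set v : E × E →ᵇ ℝ := ‖w‖ •
      (((1 : E →ᵇ ℝ) - ballCutoff E k).compContinuous ⟨Prod.fst, continuous_fst⟩ +
        ((1 : E →ᵇ ℝ) - ballCutoff E k).compContinuous ⟨Prod.snd, continuous_snd⟩) with hv
    have hLv : L v = ‖w‖ * (∫ x, (1 - ballCutoff E k x) ∂ν + ∫ x, (1 - ballCutoff E k x) ∂μ) := by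
      rw [hv, map_smul, map_add, hfst, hsnd]
      rfl
    rw [← hLv]
    have hle : ∀ q, |f q - w q| ≤ v q := by
      intro q
      have h1 : f q - w q = -((1 - χ k q) * w q) := by rw [hf]; ring
      have h2 : v q = ‖w‖ * ((1 - ballCutoff E k q.1) + (1 - ballCutoff E k q.2)) := rfl
      rw [h1, h2, abs_neg, abs_mul, abs_of_nonneg (sub_nonneg.2 (hχ1 k q)), mul_comm]
      refine mul_le_mul (w.norm_coe_le_norm q) ?_ (sub_nonneg.2 (hχ1 k q)) (norm_nonneg _)
      have := mul_nonneg (sub_nonneg.2 (ballCutoff_le_one k q.1))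
        (sub_nonneg.2 (ballCutoff_le_one k q.2))
      simp only [χ]
      linarith
    rw [Real.norm_eq_abs, abs_le]
    constructor
    · rw [← map_neg]
      exact hmono _ _ fun q => (abs_le.1 (hle q)).1
    · exact hmono _ _ fun q => (abs_le.1 (hle q)).2
  have : IsFiniteMeasure (π.map Prod.fst) := inferInstance
  have : IsFiniteMeasure (π.map Prod.snd) := inferInstance
  refine ⟨π, ?_, ?_, hfatou c hc hc0 D hcost⟩
  · refine ext_of_forall_integral_eq_of_IsFiniteMeasure fun φ => ?_
    rw [integral_map (by fun_prop) (by fun_prop), ← hfst, ← hlim]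
    rfl
  · refine ext_of_forall_integral_eq_of_IsFiniteMeasure fun φ => ?_
    rw [integral_map (by fun_prop) (by fun_prop), ← hsnd, ← hlim]
    rfl

end Kantorovich

section HopfLax

open Filter Topology Convolution

variable {E : Type*} [NormedAddCommGroup E]

/-- The Hopf-Lax semigroup `Q_t φ(x) = inf_y (φ(y) + |x - y|² / (2t))`. -/
noncomputable def hopfLax (φ : E → ℝ) (t : ℝ) (x : E) : ℝ :=
  ⨅ y, (φ y + ‖x - y‖ ^ 2 / (2 * t))

theorem bddBelow_hopfLax {φ : E → ℝ} {K t : ℝ} (hφ : ∀ x, |φ x| ≤ K) (ht : 0 < t) (x : E) :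
    BddBelow (Set.range fun y => φ y + ‖x - y‖ ^ 2 / (2 * t)) := by
  refine ⟨-K, ?_⟩
  rintro _ ⟨y, rfl⟩
  have h1 := (abs_le.1 (hφ y)).1
  have h2 : 0 ≤ ‖x - y‖ ^ 2 / (2 * t) := by positivity
  simp only
  linarith

theorem hopfLax_le_add {φ : E → ℝ} {K t : ℝ} (hφ : ∀ x, |φ x| ≤ K) (ht : 0 < t) (x y : E) :
    hopfLax φ t x ≤ φ y + ‖x - y‖ ^ 2 / (2 * t) :=
  ciInf_le (bddBelow_hopfLax hφ ht x) y

theorem hopfLax_le {φ : E → ℝ} {K t : ℝ} (hφ : ∀ x, |φ x| ≤ K) (ht : 0 < t) (x : E) :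
    hopfLax φ t x ≤ φ x := by
  simpa using hopfLax_le_add hφ ht x x

theorem abs_hopfLax_le {φ : E → ℝ} {K t : ℝ} (hφ : ∀ x, |φ x| ≤ K) (ht : 0 < t) (x : E) :
    |hopfLax φ t x| ≤ K := by
  rw [abs_le]
  refine ⟨le_ciInf fun y => ?_, (hopfLax_le hφ ht x).trans (abs_le.1 (hφ x)).2⟩
  have h1 := (abs_le.1 (hφ y)).1
  have h2 : 0 ≤ ‖x - y‖ ^ 2 / (2 * t) := by positivity
  linarith

theorem hopfLax_add_le_div_mul {φ : E → ℝ} {K t t' : ℝ} (hφ : ∀ x, |φ x| ≤ K) (ht : 0 < t)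
    (htt' : t ≤ t') (x : E) : hopfLax φ t x + K ≤ t' / t * (hopfLax φ t' x + K) := by
  have ht' : 0 < t' := ht.trans_le htt'
  rw [← div_le_iff₀' (by positivity), ← sub_le_iff_le_add]
  refine le_ciInf fun y => ?_
  rw [sub_le_iff_le_add, div_le_iff₀' (by positivity)]
  have h1 := hopfLax_le_add hφ ht x y
  have h2 := (abs_le.1 (hφ y)).1
  have h3 : t' / t * (φ y + ‖x - y‖ ^ 2 / (2 * t') + K) =
      t' / t * (φ y + K) + ‖x - y‖ ^ 2 / (2 * t) := by
    field_simp
    ring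
  have h4 : 1 * (φ y + K) ≤ t' / t * (φ y + K) :=
    mul_le_mul_of_nonneg_right ((one_le_div ht).2 htt') (by linarith)
  linarith

theorem measurable_hopfLax [MeasurableSpace E] [BorelSpace E] {φ : E → ℝ} {K t : ℝ}
    (hφ : ∀ x, |φ x| ≤ K) (ht : 0 < t) : Measurable (hopfLax φ t) := by
  refine UpperSemicontinuous.measurable ?_
  refine upperSemicontinuous_ciInf (bddBelow_hopfLax hφ ht) fun y => ?_
  exact Continuous.upperSemicontinuous (by fun_prop)

variable [NormedSpace ℝ E]

theorem hopfLax_add_le {φ : E → ℝ} {K t ε : ℝ} (hφ : ∀ x, |φ x| ≤ K) (ht : 0 < t) (hε : 0 < ε)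
    (x v : E) : hopfLax φ (t + ε) x ≤ hopfLax φ t (x - ε • v) + ε * ‖v‖ ^ 2 / 2 := by
  rw [← sub_le_iff_le_add]
  refine le_ciInf fun y => ?_
  have h1 := hopfLax_le_add hφ (add_pos ht hε) x y
  have h2 : ‖x - y‖ ≤ ‖x - ε • v - y‖ + ε * ‖v‖ := by
    have := norm_add_le (x - ε • v - y) (ε • v)
    rw [norm_smul, Real.norm_of_nonneg hε.le] at this
    rwa [show x - ε • v - y + ε • v = x - y by abel] at this
  set A := ‖x - ε • v - y‖
  set B := ‖v‖
  have h3 : ‖x - y‖ ^ 2 ≤ (A + ε * B) ^ 2 := by gcongr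
  have h4 : ‖x - y‖ ^ 2 / (2 * (t + ε)) ≤ A ^ 2 / (2 * t) + ε * B ^ 2 / 2 := by
    rw [div_le_iff₀ (by positivity)]
    refine h3.trans ?_
    have h5 : (A ^ 2 / (2 * t) + ε * B ^ 2 / 2) * (2 * (t + ε)) - (A + ε * B) ^ 2 =
        ε / t * (A - t * B) ^ 2 := by
      field_simp
      ring
    have h6 : 0 ≤ ε / t * (A - t * B) ^ 2 := by positivity
    linarith
  linarith

/-- A family of bounded `C¹` functions which is a discrete subsolution of the Hamilton-Jacobi
equation `∂_t u + |∇u|² / 2 = 0` and decreases in time at a controlled rate. -/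
structure IsSmoothHJSubsolution (U : ℝ → E → ℝ) (K : ℝ) : Prop where
  contDiff : ∀ t, 0 < t → ContDiff ℝ 1 (U t)
  abs_le : ∀ t, 0 < t → ∀ x, |U t x| ≤ K
  step : ∀ t ε, 0 < t → 0 < ε → ∀ x v, U (t + ε) x ≤ U t (x - ε • v) + ε * ‖v‖ ^ 2 / 2
  scale : ∀ t t', 0 < t → t ≤ t' → ∀ x, U t x + K ≤ t' / t * (U t' x + K)

theorem IsSmoothHJSubsolution.antitone {U : ℝ → E → ℝ} {K : ℝ}
    (hU : IsSmoothHJSubsolution U K) {t t' : ℝ} (ht : 0 < t) (htt' : t < t') (x : E) :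
    U t' x ≤ U t x := by
  simpa using hU.step t (t' - t) ht (sub_pos.2 htt') x 0

variable [MeasurableSpace E] [BorelSpace E]

theorem IsSmoothHJSubsolution.measurable {U : ℝ → E → ℝ} {K : ℝ}
    (hU : IsSmoothHJSubsolution U K) {t : ℝ} (ht : 0 < t) : Measurable (U t) :=
  (hU.contDiff t ht).continuous.measurable

variable [FiniteDimensional ℝ E] (vol : Measure E)
  [vol.IsAddHaarMeasure] (J : ContDiffBump (0 : E))

theorem integrable_normed_mul {g : E → ℝ} {K : ℝ} (hg : Measurable g) (hK : ∀ x, |g x| ≤ K)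
    (x : E) : Integrable (fun z => J.normed vol z * g (x - z)) vol :=
  J.integrable_normed.mul_bdd (c := K)
    (hg.comp (continuous_const.sub continuous_id).measurable).aestronglyMeasurable
    (ae_of_all _ fun _ => hK _)

/-- Mollification by a smooth bump function. -/
noncomputable def mollify (g : E → ℝ) (x : E) : ℝ := ∫ z, J.normed vol z * g (x - z) ∂vol

theorem mollify_mono_add {g h : E → ℝ} {K K' : ℝ} (hg : Measurable g) (hK : ∀ x, |g x| ≤ K)
    (hh : Measurable h) (hK' : ∀ x, |h x| ≤ K') {a b : ℝ} {x y : E}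
    (hgh : ∀ z, g (x - z) ≤ a * h (y - z) + b) :
    mollify vol J g x ≤ a * mollify vol J h y + b := by
  have h1 := integrable_normed_mul vol J hg hK x
  have h2 := integrable_normed_mul vol J hh hK' y
  have h3 : a * mollify vol J h y + b =
      ∫ z, (a * (J.normed vol z * h (y - z)) + J.normed vol z * b) ∂vol := by
    rw [integral_add (h2.const_mul a) (J.integrable_normed.mul_const b), integral_const_mul,
      integral_mul_const, J.integral_normed, one_mul]
    rfl
  rw [h3]
  refine integral_mono h1 ((h2.const_mul a).add (J.integrable_normed.mul_const b)) fun z => ?_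
  have := mul_le_mul_of_nonneg_left (hgh z) (J.nonneg_normed (μ := vol) z)
  simp only
  linarith

theorem abs_mollify_le {g : E → ℝ} {K : ℝ} (hg : Measurable g) (hK : ∀ x, |g x| ≤ K) (x : E) :
    |mollify vol J g x| ≤ K := by
  rw [abs_le]
  constructor
  · have := mollify_mono_add vol J (g := fun _ => -K) (h := g) (a := 1) (b := 0) (x := x) (y := x)
      (K := |K|) measurable_const (fun _ => by simp) hg hK
      (fun z => by linarith [(abs_le.1 (hK (x - z))).1])
    have h2 : mollify vol J (fun _ => -K) x = -K := by
      rw [mollify, integral_mul_const, J.integral_normed, one_mul]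
    linarith
  · have := mollify_mono_add vol J (g := g) (h := g) (a := 0) (b := K) (x := x) (y := x)
      hg hK hg hK (fun z => by linarith [(abs_le.1 (hK (x - z))).2])
    linarith

theorem contDiff_mollify {g : E → ℝ} {K : ℝ} (hg : Measurable g) (hK : ∀ x, |g x| ≤ K) :
    ContDiff ℝ 1 (mollify vol J g) := by
  change ContDiff ℝ 1 (J.normed vol ⋆[ContinuousLinearMap.lsmul ℝ ℝ, vol] g)
  refine J.hasCompactSupport_normed.contDiff_convolution_left _ J.contDiff_normed ?_
  exact (locallyIntegrable_const K).mono hg.aestronglyMeasurable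
    (ae_of_all _ fun x => (hK x).trans (le_abs_self K))

theorem tendsto_integral_mul_mollify {μ : Measure E} {J : ℕ → ContDiffBump (0 : E)}
    (hJ : Tendsto (fun n => (J n).rOut) atTop (𝓝 0)) {f g : E → ℝ} {K : ℝ} (hf : Integrable f μ)
    (hg : Continuous g) (hK : ∀ x, |g x| ≤ K) :
    Tendsto (fun n => ∫ x, f x * mollify vol (J n) g x ∂μ) atTop (𝓝 (∫ x, f x * g x ∂μ)) := by
  refine tendsto_integral_of_dominated_convergence (fun x => |f x| * K) (fun n => ?_)
    (hf.abs.mul_const K) (fun n => ?_) ?_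
  · exact hf.aestronglyMeasurable.mul
      (contDiff_mollify vol (J n) hg.measurable hK).continuous.measurable.aestronglyMeasurable
  · refine ae_of_all _ fun x => ?_
    rw [norm_mul]
    exact mul_le_mul_of_nonneg_left (abs_mollify_le vol (J n) hg.measurable hK x) (abs_nonneg _)
  · exact ae_of_all _ fun x =>
      (ContDiffBump.convolution_tendsto_right_of_continuous hJ hg x).const_mul _

theorem isSmoothHJSubsolution_mollify_hopfLax {φ : E → ℝ} {K : ℝ} (hφ : ∀ x, |φ x| ≤ K) :
    IsSmoothHJSubsolution (fun t => mollify vol J (hopfLax φ t)) K where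
  contDiff t ht := contDiff_mollify vol J (measurable_hopfLax hφ ht) (abs_hopfLax_le hφ ht)
  abs_le t ht := abs_mollify_le vol J (measurable_hopfLax hφ ht) (abs_hopfLax_le hφ ht)
  step t ε ht hε x v := by
    have := mollify_mono_add vol J (measurable_hopfLax hφ (add_pos ht hε))
      (abs_hopfLax_le hφ (add_pos ht hε)) (measurable_hopfLax hφ ht) (abs_hopfLax_le hφ ht)
      (a := 1) (b := ε * ‖v‖ ^ 2 / 2) (x := x) (y := x - ε • v) fun z => by
        have := hopfLax_add_le hφ ht hε (x - z) v
        rwa [one_mul, sub_right_comm x]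
    simpa using this
  scale t t' ht htt' x := by
    have := mollify_mono_add vol J (measurable_hopfLax hφ ht) (abs_hopfLax_le hφ ht)
      (measurable_hopfLax hφ (ht.trans_le htt')) (abs_hopfLax_le hφ (ht.trans_le htt'))
      (a := t' / t) (b := t' / t * K - K) (x := x) (y := x) fun z => by
        have := hopfLax_add_le_div_mul hφ ht htt' (x - z)
        linarith
    linarith

end HopfLax

section Entropy

open ProbabilityTheory Filter Topology InnerProductSpace

section Bounded

variable {Ω : Type*} [MeasurableSpace Ω] {μ : Measure Ω} [IsProbabilityMeasure μ] {X : Ω → ℝ}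
  {K : ℝ}

theorem integrable_exp_mul_of_abs_le (hX : Measurable X) (hK : ∀ x, |X x| ≤ K) (s : ℝ) :
    Integrable (fun x => Real.exp (s * X x)) μ :=
  integrable_exp_mul_of_mem_Icc hX.aemeasurable (ae_of_all _ fun x => abs_le.1 (hK x))

theorem mem_interior_integrableExpSet_of_abs_le (hX : Measurable X) (hK : ∀ x, |X x| ≤ K)
    (s : ℝ) : s ∈ interior (integrableExpSet X μ) := by
  have : integrableExpSet X μ = Set.univ :=
    Set.eq_univ_of_forall fun t => integrable_exp_mul_of_abs_le hX hK t
  simp [this]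

theorem mgf_pos_of_abs_le (hX : Measurable X) (hK : ∀ x, |X x| ≤ K) (s : ℝ) : 0 < mgf X μ s :=
  mgf_pos (integrable_exp_mul_of_abs_le hX hK s)

theorem hasDerivAt_cgf_of_abs_le (hX : Measurable X) (hK : ∀ x, |X x| ≤ K) (s : ℝ) :
    HasDerivAt (cgf X μ) (deriv (cgf X μ) s) s := by
  refine DifferentiableAt.hasDerivAt ?_
  have h := hasDerivAt_mgf (mem_interior_integrableExpSet_of_abs_le (μ := μ) hX hK s)
  exact h.differentiableAt.log (mgf_pos_of_abs_le hX hK s).ne'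

theorem cgf_le_of_le_add {Y : Ω → ℝ} {K' c s : ℝ} (hX : Measurable X) (hK : ∀ x, |X x| ≤ K)
    (hY : Measurable Y) (hK' : ∀ x, |Y x| ≤ K') (hs : 0 ≤ s) (h : ∀ x, X x ≤ Y x + c) :
    cgf X μ s ≤ cgf Y μ s + s * c := by
  have h1 : mgf X μ s ≤ mgf Y μ s * Real.exp (s * c) := by
    rw [mgf, mgf, ← integral_mul_const]
    refine integral_mono (integrable_exp_mul_of_abs_le hX hK s)
      ((integrable_exp_mul_of_abs_le hY hK' s).mul_const _) fun x => ?_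
    simp only
    rw [← Real.exp_add, Real.exp_le_exp, ← mul_add]
    exact mul_le_mul_of_nonneg_left (h x) hs
  have h2 := Real.log_le_log (mgf_pos_of_abs_le hX hK s) h1
  rwa [Real.log_mul (mgf_pos_of_abs_le hY hK' s).ne' (Real.exp_pos _).ne', Real.log_exp] at h2

theorem le_of_isMinOn_cgf_add_div (hX : Measurable X) (hK : ∀ x, |X x| ≤ K)
    {a b s r : ℝ} (ha : 0 < a) (has : a ≤ s) (hsb : s < b)
    (hmin : IsMinOn (fun s => (cgf X μ s + r) / s) (Set.Icc a b) s) :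
    r ≤ s * deriv (cgf X μ) s - cgf X μ s := by
  have hs : 0 < s := ha.trans_le has
  have hd := ((hasDerivAt_cgf_of_abs_le (μ := μ) hX hK s).add_const r).div (hasDerivAt_id' s) hs.ne'
  have h1 : ∀ᶠ t in 𝓝[>] (0 : ℝ), t < b - s :=
    mem_nhdsWithin_of_mem_nhds (Iio_mem_nhds (sub_pos.2 hsb))
  have h0 := ge_of_tendsto hd.tendsto_slope_zero_right <| by
    filter_upwards [self_mem_nhdsWithin, h1] with t ht htb
    have ht : 0 < t := ht
    have := isMinOn_iff.1 hmin (s + t) ⟨by linarith, by linarith⟩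
    exact smul_nonneg (inv_nonneg.2 ht.le) (sub_nonneg.2 this)
  rw [le_div_iff₀ (by positivity), zero_mul] at h0
  linarith

end Bounded

variable {E : Type*} [NormedAddCommGroup E] [InnerProductSpace ℝ E]

theorem IsSmoothHJSubsolution.cgf_add_div_sub_le [MeasurableSpace E] [BorelSpace E]
    {μ : Measure E} [IsProbabilityMeasure μ] {U : ℝ → E → ℝ} {K : ℝ}
    (hU : IsSmoothHJSubsolution U K) {t t' r r' a s : ℝ} (ht : 0 < t) (ht' : 0 < t')
    (ha : 0 < a) (has : a ≤ s) :
    (cgf (U t) μ s + r) / s - (cgf (U t') μ s + r') / s ≤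
      2 * K * |t' / t - 1| + |r - r'| / a := by
  have hs : 0 < s := ha.trans_le has
  have hK : 0 ≤ K := (abs_nonneg _).trans (hU.abs_le t ht 0)
  have h1 : (r - r') / s ≤ |r - r'| / a :=
    (div_le_div_of_nonneg_right (le_abs_self _) hs.le).trans
      (div_le_div_of_nonneg_left (abs_nonneg _) ha has)
  have h2 : cgf (U t) μ s ≤ cgf (U t') μ s + s * (2 * K * |t' / t - 1|) := by
    refine cgf_le_of_le_add (hU.measurable ht) (hU.abs_le t ht) (hU.measurable ht')
      (hU.abs_le t' ht') hs.le fun x => ?_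
    rcases le_or_gt t t' with h | h
    · have h3 := hU.scale t t' ht h x
      have h4 : 0 ≤ t' / t - 1 := by rwa [sub_nonneg, one_le_div ht]
      rw [abs_of_nonneg h4]
      have h5 := mul_le_mul_of_nonneg_left (_root_.abs_le.1 (hU.abs_le t' ht' x)).2 h4
      linarith
    · have h3 : 0 ≤ 2 * K * |t' / t - 1| := by positivity
      linarith [hU.antitone ht' h x]
  rw [← _root_.sub_div, div_le_iff₀ hs]
  rw [div_le_iff₀ hs] at h1
  linarith

variable [CompleteSpace E]

theorem tendsto_exp_slope_neg_gradient {U : E → ℝ} (hU : ContDiff ℝ 1 U) (s : ℝ) (x : E)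
    {τ : ℕ → ℝ} (hτ : ∀ n, 0 < τ n) (hτ0 : Tendsto τ atTop (𝓝 0)) :
    Tendsto (fun n => (Real.exp (s * U x) - Real.exp (s * (U (x - τ n • gradient U x)
      + τ n * ‖gradient U x‖ ^ 2 / 2))) / τ n) atTop
      (𝓝 (s / 2 * (Real.exp (s * U x) * ‖gradient U x‖ ^ 2))) := by
  set v := gradient U x
  have hd : HasFDerivAt U (toDual ℝ E v) (x - (0 : ℝ) • v) := by
    rw [zero_smul, sub_zero]
    exact (hU.differentiable one_ne_zero x).hasGradientAt.hasFDerivAt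
  have h1 : HasDerivAt (fun t : ℝ => x - t • v) (-((1 : ℝ) • v)) 0 :=
    ((hasDerivAt_id (0 : ℝ)).smul_const v).const_sub x
  have h2 : HasDerivAt (fun t : ℝ => U (x - t • v)) (-‖v‖ ^ 2) 0 := by
    have h : toDual ℝ E v (-((1 : ℝ) • v)) = -‖v‖ ^ 2 := by simp
    rw [← h]
    exact hd.comp_hasDerivAt (0 : ℝ) h1
  have h3 : HasDerivAt (fun t : ℝ => t * ‖v‖ ^ 2 / 2) (‖v‖ ^ 2 / 2) 0 := by
    simpa using ((hasDerivAt_id (0 : ℝ)).mul_const (‖v‖ ^ 2)).div_const 2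
  have h4 := (((h2.add h3).const_mul s).exp).neg
  have h5 := h4.tendsto_slope_zero_right
  have h6 : Tendsto τ atTop (𝓝[>] 0) :=
    tendsto_nhdsWithin_iff.2 ⟨hτ0, Eventually.of_forall hτ⟩
  refine (h5.comp h6).congr' ?_ |>.trans (le_of_eq ?_)
  · filter_upwards with n
    simp [div_eq_inv_mul]
    left
    ring
  · congr 1
    simp
    ring

variable [MeasurableSpace E]

/-- The `β`-log-Sobolev inequality, tested on bounded `C¹` functions. -/
def SatisfiesLogSobolev (β : ℝ → ℝ) (μ : Measure E) : Prop :=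
  ∀ g : E → ℝ, ContDiff ℝ 1 g → (∃ M, ∀ x, |g x| ≤ M) → (∫ x, g x ^ 2 ∂μ) = 1 →
    ENNReal.ofReal (β (∫ x, g x ^ 2 * Real.log (g x ^ 2) ∂μ)) ≤
      ∫⁻ x, (‖gradient g x‖₊ : ℝ≥0∞) ^ 2 ∂μ

variable [BorelSpace E] {μ : Measure E} [IsProbabilityMeasure μ] {β : ℝ → ℝ}

theorem SatisfiesLogSobolev.gibbs (hLSI : SatisfiesLogSobolev β μ) {U : E → ℝ} {K : ℝ}
    (hU : ContDiff ℝ 1 U) (hK : ∀ x, |U x| ≤ K) (s : ℝ) :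
    ENNReal.ofReal (β (s * deriv (cgf U μ) s - cgf U μ s)) ≤
      ∫⁻ x, ENNReal.ofReal
        (s ^ 2 / 4 / mgf U μ s * (Real.exp (s * U x) * ‖gradient U x‖ ^ 2)) ∂μ := by
  have hm : Measurable U := hU.continuous.measurable
  have hZ : 0 < mgf U μ s := mgf_pos_of_abs_le hm hK s
  have hint := mem_interior_integrableExpSet_of_abs_le (μ := μ) hm hK s
  set g : E → ℝ := fun x => Real.exp (s / 2 * U x - cgf U μ s / 2) with hg
  have hg2 : ∀ x, g x ^ 2 = Real.exp (s * U x) / mgf U μ s := fun x => by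
    rw [hg, ← Real.exp_nat_mul, ← exp_cgf (integrable_exp_mul_of_abs_le hm hK s), ← Real.exp_sub]
    congr 1
    push_cast
    ring
  have hK0 : 0 ≤ K := (abs_nonneg _).trans (hK 0)
  have key := hLSI g (by fun_prop) ⟨Real.exp (|s / 2| * K - cgf U μ s / 2), fun x => by
    rw [hg, abs_of_pos (Real.exp_pos _), Real.exp_le_exp]
    have : s / 2 * U x ≤ |s / 2| * K := (le_abs_self _).trans (by rw [abs_mul]; gcongr; exact hK x)
    linarith⟩ (by
      simp_rw [hg2]
      rw [integral_div]
      exact div_self hZ.ne')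
  have hent : ∫ x, g x ^ 2 * Real.log (g x ^ 2) ∂μ = s * deriv (cgf U μ) s - cgf U μ s := by
    have h1 : ∀ x, g x ^ 2 * Real.log (g x ^ 2) = s / mgf U μ s * (U x * Real.exp (s * U x))
        - cgf U μ s / mgf U μ s * Real.exp (s * U x) := fun x => by
      rw [hg2, Real.log_div (Real.exp_pos _).ne' hZ.ne', Real.log_exp, cgf]
      ring
    have hi : Integrable (fun x => U x * Real.exp (s * U x)) μ := by
      simpa using integrable_pow_mul_exp_of_mem_interior_integrableExpSet hint 1
    simp_rw [h1]
    rw [integral_sub (hi.const_mul _) ((integrable_exp_mul_of_abs_le hm hK s).const_mul _),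
      integral_const_mul, integral_const_mul, deriv_cgf hint]
    change _ - _ / _ * mgf U μ s = _
    field_simp
  rw [hent] at key
  refine key.trans_eq (lintegral_congr fun x => ?_)
  have hgrad : gradient g x = (g x * (s / 2)) • gradient U x := by
    have hd := (hU.differentiable one_ne_zero x).hasGradientAt
    have h1 : HasFDerivAt g (g x • ((s / 2) • (toDual ℝ E (gradient U x)))) x :=
      ((hd.hasFDerivAt.const_mul (s / 2)).sub_const _).exp
    refine HasGradientAt.gradient ?_
    have h2 : toDual ℝ E ((g x * (s / 2)) • gradient U x) =
        g x • ((s / 2) • (toDual ℝ E (gradient U x))) := by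
      rw [map_smulₛₗ, smul_smul]
      rfl
    rw [hasGradientAt_iff_hasFDerivAt, h2]
    exact h1
  rw [hgrad, ← enorm_eq_nnnorm, ← ofReal_norm, ← ENNReal.ofReal_pow (norm_nonneg _)]
  congr 1
  rw [norm_smul, mul_pow, Real.norm_eq_abs, sq_abs, mul_pow, hg2]
  ring

theorem SatisfiesLogSobolev.entropy_le_of_tendsto (hLSI : SatisfiesLogSobolev β μ) {U : E → ℝ}
    {K : ℝ} (hU : ContDiff ℝ 1 U) (hK : ∀ x, |U x| ≤ K) {s : ℝ} (hs : 0 < s) {W : ℕ → E → ℝ}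
    (hWm : ∀ n, Measurable (W n)) (hWK : ∀ n x, |W n x| ≤ K) {τ : ℕ → ℝ} (hτ : ∀ n, 0 < τ n)
    (hτ0 : Tendsto τ atTop (𝓝 0))
    (hW : ∀ n x v, W n x ≤ U (x - τ n • v) + τ n * ‖v‖ ^ 2 / 2) {c : ℕ → ℝ} {c₀ : ℝ}
    (hc : ∀ n, (mgf U μ s - mgf (W n) μ s) / τ n ≤ c n) (hc₀ : Tendsto c atTop (𝓝 c₀)) :
    2 * mgf U μ s / s * β (s * deriv (cgf U μ) s - cgf U μ s) ≤ c₀ := by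
  have hm : Measurable U := hU.continuous.measurable
  have hZ : 0 < mgf U μ s := mgf_pos_of_abs_le hm hK s
  have hWU : ∀ n x, W n x ≤ U x := fun n x => by simpa using hW n x 0
  have hnn : ∀ n x, 0 ≤ (Real.exp (s * U x) - Real.exp (s * W n x)) / τ n := fun n x => by
    refine div_nonneg (sub_nonneg.2 (Real.exp_le_exp.2 ?_)) (hτ n).le
    exact mul_le_mul_of_nonneg_left (hWU n x) hs.le
  have hint : ∀ n, Integrable (fun x => (Real.exp (s * U x) - Real.exp (s * W n x)) / τ n) μ :=
    fun n => ((integrable_exp_mul_of_abs_le hm hK s).sub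
      (integrable_exp_mul_of_abs_le (hWm n) (hWK n) s)).div_const _
  have hval : ∀ n, ∫ x, (Real.exp (s * U x) - Real.exp (s * W n x)) / τ n ∂μ =
      (mgf U μ s - mgf (W n) μ s) / τ n := fun n => by
    rw [integral_div, integral_sub (integrable_exp_mul_of_abs_le hm hK s)
      (integrable_exp_mul_of_abs_le (hWm n) (hWK n) s)]
    rfl
  have hc₀0 : 0 ≤ c₀ := ge_of_tendsto' hc₀ fun n => by
    refine le_trans ?_ (hc n)
    rw [← hval]
    exact integral_nonneg (hnn n)
  have hfatou : ∫⁻ x, ENNReal.ofReal (s / 2 * (Real.exp (s * U x) * ‖gradient U x‖ ^ 2)) ∂μ ≤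
      ENNReal.ofReal c₀ := by
    calc _ ≤ ∫⁻ x, liminf (fun n => ENNReal.ofReal
          ((Real.exp (s * U x) - Real.exp (s * W n x)) / τ n)) atTop ∂μ := by
          refine lintegral_mono fun x => ?_
          simp only
          rw [← (ENNReal.tendsto_ofReal
            (tendsto_exp_slope_neg_gradient hU s x hτ hτ0)).liminf_eq]
          refine liminf_le_liminf (Eventually.of_forall fun n => ?_)
          refine ENNReal.ofReal_le_ofReal (div_le_div_of_nonneg_right ?_ (hτ n).le)
          refine sub_le_sub_left (Real.exp_le_exp.2 ?_) _
          exact mul_le_mul_of_nonneg_left (hW n x _) hs.le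
      _ ≤ liminf (fun n => ∫⁻ x, ENNReal.ofReal
          ((Real.exp (s * U x) - Real.exp (s * W n x)) / τ n) ∂μ) atTop :=
          lintegral_liminf_le fun n => by
            have := hWm n
            fun_prop
      _ ≤ liminf (fun n => ENNReal.ofReal (c n)) atTop := by
          refine liminf_le_liminf (Eventually.of_forall fun n => ?_)
          rw [← ofReal_integral_eq_lintegral_ofReal (hint n) (ae_of_all _ (hnn n)), hval]
          exact ENNReal.ofReal_le_ofReal (hc n)
      _ = ENNReal.ofReal c₀ := (ENNReal.tendsto_ofReal hc₀).liminf_eq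
  have hgibbs := hLSI.gibbs hU hK s
  have hk : 0 ≤ 2 * mgf U μ s / s := by positivity
  rw [← ENNReal.ofReal_le_ofReal_iff hc₀0, ENNReal.ofReal_mul hk]
  refine le_trans (mul_le_mul_right hgibbs _) (le_trans (le_of_eq ?_) hfatou)
  rw [← lintegral_const_mul' _ _ ENNReal.ofReal_ne_top]
  refine lintegral_congr fun x => ?_
  rw [← ENNReal.ofReal_mul hk]
  congr 1
  field_simp
  ring

theorem frequently_slope_lt (hLSI : SatisfiesLogSobolev β μ) (hβmono : StrictMonoOn β (Set.Ici 0))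
    (hβ0 : β 0 = 0) {U : ℝ → E → ℝ} {K : ℝ} (hU : IsSmoothHJSubsolution U K) {G : ℝ → ℝ} {r : ℝ}
    (hr : 0 < r) (hGr : 0 < G r) (hG : HasDerivAt G (1 / (2 * √(β r))) r)
    (hGmono : StrictMonoOn G (Set.Ioi 0)) {s : ℝ} (hs : 0 < s)
    (hE : r ≤ s * deriv (cgf (U (G r)) μ) s - cgf (U (G r)) μ s) {ρ : ℝ}
    (hρ : 1 / (4 * √(β r)) < ρ) :
    ∃ᶠ z in 𝓝[>] r,
      (cgf (U (G z)) μ s + z) / s - (cgf (U (G r)) μ s + r) / s < ρ * (z - r) := by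
  intro hcon
  obtain ⟨u, hu, hsub⟩ := mem_nhdsGT_iff_exists_Ioo_subset.1 hcon
  have hu : r < u := hu
  set q := √(β r) with hq
  have hβr : 0 < β r := hβ0 ▸ hβmono Set.self_mem_Ici hr.le hr
  have hq0 : 0 < q := Real.sqrt_pos.2 hβr
  have hq2 : q ^ 2 = β r := Real.sq_sqrt hβr.le
  set h : ℕ → ℝ := fun n => (u - r) * (1 / ((n + 1 : ℕ) + 1 : ℝ)) with hh
  have hh0 : ∀ n, 0 < h n := fun n => mul_pos (sub_pos.2 hu) (by positivity)
  have hhu : ∀ n, r + h n < u := fun n => by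
    have : 1 / (((n + 1 : ℕ) : ℝ) + 1) < 1 := by
      rw [div_lt_one (by positivity)]
      push_cast
      linarith [(Nat.cast_nonneg n : (0 : ℝ) ≤ n)]
    have := mul_lt_mul_of_pos_left this (sub_pos.2 hu)
    simp only [hh]
    linarith
  have hhlim : Tendsto h atTop (𝓝 0) := by
    have := (tendsto_one_div_add_atTop_nhds_zero_nat (𝕜 := ℝ)).comp (tendsto_add_atTop_nat 1)
    simpa [hh, Function.comp_def] using this.const_mul (u - r)
  have hhlim' : Tendsto h atTop (𝓝[>] 0) :=
    tendsto_nhdsWithin_iff.2 ⟨hhlim, Eventually.of_forall hh0⟩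
  have hz : ∀ n, 0 < r + h n := fun n => by linarith [hh0 n]
  have hGlt : ∀ n, G r < G (r + h n) := fun n => hGmono hr (hz n) (by linarith [hh0 n])
  have hGz : ∀ n, 0 < G (r + h n) := fun n => hGr.trans (hGlt n)
  set τ : ℕ → ℝ := fun n => G (r + h n) - G r with hτdef
  have hτ : ∀ n, 0 < τ n := fun n => sub_pos.2 (hGlt n)
  have hslope : Tendsto (fun n => h n / τ n) atTop (𝓝 (2 * q)) := by
    have := (hG.tendsto_slope_zero_right.comp hhlim').inv₀ (by positivity)
    simpa [hτdef, div_eq_mul_inv, mul_comm, Function.comp_def] using this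
  have hτ0 : Tendsto τ atTop (𝓝 0) := by
    have h1 : Tendsto (fun n => r + h n) atTop (𝓝 r) := by simpa using hhlim.const_add r
    simpa using (hG.continuousAt.tendsto.comp h1).sub_const (G r)
  have hZ : 0 < mgf (U (G r)) μ s := mgf_pos_of_abs_le (hU.measurable hGr) (hU.abs_le _ hGr) s
  have key := hLSI.entropy_le_of_tendsto (hU.contDiff _ hGr) (hU.abs_le _ hGr) hs
    (W := fun n => U (G (r + h n))) (fun n => hU.measurable (hGz n)) (fun n => hU.abs_le _ (hGz n))
    hτ hτ0 (fun n x v => by simpa [hτdef] using hU.step (G r) (τ n) hGr (hτ n) x v)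
    (c := fun n => (1 - ρ * s) * mgf (U (G r)) μ s * (h n / τ n)) (fun n => by
      have h1 : ρ * h n ≤ (cgf (U (G (r + h n))) μ s + (r + h n)) / s
          - (cgf (U (G r)) μ s + r) / s := by
        simpa using hsub ⟨by linarith [hh0 n], hhu n⟩
      have hZn : 0 < mgf (U (G (r + h n))) μ s :=
        mgf_pos_of_abs_le (hU.measurable (hGz n)) (hU.abs_le _ (hGz n)) s
      have h2 := Real.log_le_sub_one_of_pos (div_pos hZn hZ)
      rw [Real.log_div hZn.ne' hZ.ne'] at h2
      rw [← _root_.sub_div, le_div_iff₀ hs, cgf, cgf] at h1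
      have h3 : mgf (U (G (r + h n))) μ s / mgf (U (G r)) μ s - 1 ≥ (ρ * s - 1) * h n := by
        linarith
      rw [ge_iff_le, le_sub_iff_add_le, le_div_iff₀ hZ] at h3
      rw [← mul_div_assoc]
      refine div_le_div_of_nonneg_right ?_ (hτ n).le
      linarith) (hslope.const_mul _)
  have hβE : q ^ 2 ≤ β (s * deriv (cgf (U (G r)) μ) s - cgf (U (G r)) μ s) := by
    rw [hq2]
    exact hβmono.monotoneOn hr.le (hr.le.trans hE) hE
  have h1 : 2 * mgf (U (G r)) μ s / s * q ^ 2 ≤ (1 - ρ * s) * mgf (U (G r)) μ s * (2 * q) :=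
    (mul_le_mul_of_nonneg_left hβE (by positivity)).trans key
  have h2 : q ≤ (1 - ρ * s) * s := by
    have : 2 * mgf (U (G r)) μ s / s * q ^ 2 = q / s * (2 * q * mgf (U (G r)) μ s) := by
      field_simp
    rw [this, show (1 - ρ * s) * mgf (U (G r)) μ s * (2 * q) =
      (1 - ρ * s) * (2 * q * mgf (U (G r)) μ s) by ring] at h1
    have := le_of_mul_le_mul_right h1 (by positivity)
    rwa [div_le_iff₀ hs] at this
  rw [div_lt_iff₀ (by positivity)] at hρ
  have h3 : 1 * s ^ 2 < ρ * (4 * q) * s ^ 2 := mul_lt_mul_of_pos_right hρ (by positivity)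
  have h4 : q * (4 * q) ≤ (1 - ρ * s) * s * (4 * q) :=
    mul_le_mul_of_nonneg_right h2 (by positivity)
  nlinarith [sq_nonneg (2 * q - s)]

theorem SatisfiesLogSobolev.exists_cgf_add_div_le (hLSI : SatisfiesLogSobolev β μ)
    (hβmono : StrictMonoOn β (Set.Ici 0)) (hβ0 : β 0 = 0) {U : ℝ → E → ℝ} {K : ℝ}
    (hU : IsSmoothHJSubsolution U K) {G : ℝ → ℝ} (hGpos : ∀ r, 0 < r → 0 < G r)
    (hG : ∀ r, 0 < r → HasDerivAt G (1 / (2 * √(β r))) r)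
    (hGmono : StrictMonoOn G (Set.Ioi 0)) {r₀ h a : ℝ} (hr₀ : 0 < r₀) (hr₀h : r₀ ≤ h)
    (ha : 0 < a) :
    ∃ s, a ≤ s ∧ (cgf (U (G h)) μ s + h) / s ≤
      (cgf (U (G r₀)) μ a + r₀) / a + (G h - G r₀) / 2 := by
  set b := max a (4 * √(β h)) with hb
  have hab : a ≤ b := le_max_left _ _
  set F : ℝ → ℝ → ℝ := fun r s => (cgf (U (G r)) μ s + r) / s with hF
  have hFcont : ∀ r, 0 < r → ContinuousOn (F r) (Set.Icc a b) := fun r hr => by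
    refine ContinuousOn.div (ContinuousOn.add (fun s _ => ?_) continuousOn_const) continuousOn_id
      fun s hs => (ha.trans_le hs.1).ne'
    exact (hasDerivAt_cgf_of_abs_le (hU.measurable (hGpos r hr)) (hU.abs_le _ (hGpos r hr))
      s).continuousAt.continuousWithinAt
  have hex : ∀ r, ∃ s, 0 < r → s ∈ Set.Icc a b ∧ IsMinOn (F r) (Set.Icc a b) s := fun r => by
    by_cases hr : 0 < r
    · obtain ⟨s, hs, hmin⟩ := isCompact_Icc.exists_isMinOn ⟨a, le_rfl, hab⟩ (hFcont r hr)
      exact ⟨s, fun _ => ⟨hs, hmin⟩⟩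
    · exact ⟨0, fun h => absurd h hr⟩
  choose σ hσ using hex
  set M : ℝ → ℝ := fun r => F r (σ r) with hM
  have hMle : ∀ r s, 0 < r → s ∈ Set.Icc a b → M r ≤ F r s := fun r s hr hs =>
    isMinOn_iff.1 (hσ r hr).2 s hs
  have hMsub : ∀ r r', 0 < r → 0 < r' →
      M r - M r' ≤ 2 * K * |G r' / G r - 1| + |r - r'| / a := fun r r' hr hr' =>
    (sub_le_sub_right (hMle r _ hr (hσ r' hr').1) _).trans
      (hU.cgf_add_div_sub_le (hGpos r hr) (hGpos r' hr') ha (hσ r' hr').1.1)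
  have hMcont : ∀ r, 0 < r → ContinuousAt M r := fun r hr => by
    have hGr := (hGpos r hr).ne'
    have h1 : Tendsto (fun z => 2 * K * |G r / G z - 1| + 2 * K * |G z / G r - 1| + |z - r| / a)
        (𝓝 r) (𝓝 0) := by
      have hc : ContinuousAt (fun z => 2 * K * |G r / G z - 1| + 2 * K * |G z / G r - 1|
          + |z - r| / a) r := by
        have := (hG r hr).continuousAt
        fun_prop (disch := assumption)
      simpa [ContinuousAt, div_self hGr] using hc
    refine tendsto_iff_dist_tendsto_zero.2
      (squeeze_zero' (Eventually.of_forall fun _ => dist_nonneg) ?_ h1)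
    filter_upwards [lt_mem_nhds hr] with z hz
    have h2 := hMsub z r hz hr
    have h3 := hMsub r z hr hz
    have hK : 0 ≤ K := (abs_nonneg _).trans (hU.abs_le _ (hGpos r hr) 0)
    have h4 : 0 ≤ 2 * K * |G r / G z - 1| := by positivity
    have h5 : 0 ≤ 2 * K * |G z / G r - 1| := by positivity
    rw [abs_sub_comm r z] at h3
    rw [Real.dist_eq, _root_.abs_le]
    constructor <;> linarith
  have hβpos : ∀ r, 0 < r → 0 < √(β r) := fun r hr =>
    Real.sqrt_pos.2 (hβ0 ▸ hβmono Set.self_mem_Ici hr.le hr)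
  have main := image_le_of_liminf_slope_right_le_deriv_boundary (f := M) (a := r₀) (b := h)
    (B := fun r => M r₀ + (G r - G r₀) / 2) (B' := fun r => 1 / (2 * √(β r)) / 2)
    (fun r hr => (hMcont r (hr₀.trans_le hr.1)).continuousWithinAt) (by simp)
    (fun r hr => ((((hG r (hr₀.trans_le hr.1)).sub_const _).div_const 2).const_add
      _).continuousAt.continuousWithinAt)
    (fun r hr => ((((hG r (hr₀.trans_le hr.1)).sub_const _).div_const 2).const_add
      _).hasDerivWithinAt)
    (fun r hr ρ hρ => by
      have hr0 : 0 < r := hr₀.trans_le hr.1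
      have hq := hβpos r hr0
      obtain ⟨hs, hmin⟩ := hσ r hr0
      have hs0 : 0 < σ r := ha.trans_le hs.1
      have hρ' : 1 / (4 * √(β r)) < ρ := by
        convert hρ using 1
        field_simp
        norm_num
      have key : ∃ᶠ z in 𝓝[>] r, F z (σ r) - F r (σ r) < ρ * (z - r) := by
        rcases hs.2.lt_or_eq with hlt | heq
        · exact frequently_slope_lt hLSI hβmono hβ0 hU hr0 (hGpos r hr0) (hG r hr0) hGmono hs0
            (le_of_isMinOn_cgf_add_div (hU.measurable (hGpos r hr0)) (hU.abs_le _ (hGpos r hr0))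
              ha hs.1 hlt hmin) hρ'
        · refine Eventually.frequently ?_
          filter_upwards [self_mem_nhdsWithin] with z hz
          have hz : r < z := hz
          have hz0 : 0 < z := hr0.trans hz
          have h1 : cgf (U (G z)) μ (σ r) ≤ cgf (U (G r)) μ (σ r) + σ r * 0 :=
            cgf_le_of_le_add (hU.measurable (hGpos z hz0)) (hU.abs_le _ (hGpos z hz0))
              (hU.measurable (hGpos r hr0)) (hU.abs_le _ (hGpos r hr0)) hs0.le fun x => by
                simpa using hU.antitone (hGpos r hr0) (hGmono hr0 hz0 hz) x
          have h2 : 4 * √(β r) ≤ σ r := by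
            rw [heq]
            refine le_trans ?_ (le_max_right _ _)
            have := Real.sqrt_le_sqrt
              (hβmono.monotoneOn hr0.le (hr0.le.trans hr.2.le) hr.2.le)
            linarith
          have h3 : 1 < ρ * σ r := by
            rw [div_lt_iff₀ (by positivity)] at hρ'
            refine hρ'.trans_le (mul_le_mul_of_nonneg_left h2 ?_)
            by_contra hneg
            nlinarith
          simp only [hF]
          rw [← _root_.sub_div, div_lt_iff₀ hs0]
          nlinarith
      refine (key.and_eventually self_mem_nhdsWithin).mono fun z hz => ?_
      have hz' : r < z := hz.2
      rw [slope_def_field, div_lt_iff₀ (sub_pos.2 hz')]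
      exact (sub_le_sub_right (hMle z _ (hr0.trans hz') hs) _).trans_lt hz.1)
    (Set.right_mem_Icc.2 hr₀h)
  exact ⟨σ h, (hσ h (hr₀.trans_le hr₀h)).1.1,
    main.trans (add_le_add_left (hMle r₀ a hr₀ ⟨le_rfl, hab⟩) _)⟩

theorem mul_le_mul_log_sub_add_exp {a : ℝ} (ha : 0 ≤ a) (b : ℝ) :
    a * b ≤ a * Real.log a - a + Real.exp b := by
  rcases ha.eq_or_lt with rfl | ha
  · simpa using (Real.exp_pos b).le
  · have h1 := mul_le_mul_of_nonneg_left (Real.add_one_le_exp (b - Real.log a)) ha.le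
    rw [Real.exp_sub, Real.exp_log ha, mul_div_cancel₀ _ ha.ne'] at h1
    linarith

theorem mul_integral_mul_le_cgf_add {Ω : Type*} [MeasurableSpace Ω] {μ : Measure Ω}
    [IsProbabilityMeasure μ] {X f : Ω → ℝ} {K : ℝ} (hX : Measurable X) (hK : ∀ x, |X x| ≤ K)
    (hf0 : ∀ x, 0 ≤ f x) (hfi : Integrable f μ) (hf1 : ∫ x, f x ∂μ = 1)
    (hfl : Integrable (fun x => f x * Real.log (f x)) μ) (s : ℝ) :
    s * ∫ x, f x * X x ∂μ ≤ cgf X μ s + ∫ x, f x * Real.log (f x) ∂μ := by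
  have hi := integrable_exp_mul_of_abs_le (μ := μ) hX hK s
  have hfX : Integrable (fun x => f x * X x) μ :=
    hfi.mul_bdd (c := K) hX.aestronglyMeasurable (ae_of_all _ hK)
  have hZ := mgf_pos_of_abs_le (μ := μ) hX hK s
  have hfsub : Integrable (fun x => f x * Real.log (f x) - f x) μ := hfl.sub hfi
  have h1 : ∫ x, (s * (f x * X x) - cgf X μ s * f x) ∂μ ≤
      ∫ x, (f x * Real.log (f x) - f x + Real.exp (s * X x) / mgf X μ s) ∂μ := by
    refine integral_mono ((hfX.const_mul s).sub (hfi.const_mul _))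
      (hfsub.add (hi.div_const _)) fun x => ?_
    have h2 := mul_le_mul_log_sub_add_exp (hf0 x) (s * X x - cgf X μ s)
    rw [Real.exp_sub, exp_cgf hi] at h2
    simp only
    linarith
  rw [integral_sub (hfX.const_mul s) (hfi.const_mul _), integral_const_mul, integral_const_mul,
    integral_add hfsub (hi.div_const _), integral_sub hfl hfi, integral_div, hf1] at h1
  have h3 : (∫ x, Real.exp (s * X x) ∂μ) / mgf X μ s = 1 := div_self hZ.ne'
  linarith

theorem SatisfiesLogSobolev.integral_mollify_le [FiniteDimensional ℝ E]
    (hLSI : SatisfiesLogSobolev β μ) (hβmono : StrictMonoOn β (Set.Ici 0)) (hβ0 : β 0 = 0)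
    {G : ℝ → ℝ} (hGpos : ∀ r, 0 < r → 0 < G r)
    (hG : ∀ r, 0 < r → HasDerivAt G (1 / (2 * √(β r))) r)
    (hGmono : StrictMonoOn G (Set.Ioi 0)) {f φ ψ : E → ℝ} {h K : ℝ} (hh : 0 < h)
    (hf0 : ∀ x, 0 ≤ f x) (hfi : Integrable f μ) (hf1 : ∫ x, f x ∂μ = 1)
    (hfl : Integrable (fun x => f x * Real.log (f x)) μ)
    (hfh : ∫ x, f x * Real.log (f x) ∂μ ≤ h) (hφm : Measurable φ) (hφ : ∀ x, |φ x| ≤ K)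
    (hψm : Measurable ψ) (hψ : ∀ x, |ψ x| ≤ K)
    (hψφ : ∀ x y, ψ x ≤ φ y + ‖x - y‖ ^ 2 / (2 * G h))
    (vol : Measure E) [vol.IsAddHaarMeasure] (J : ContDiffBump (0 : E)) :
    ∫ x, f x * mollify vol J ψ x ∂μ ≤ ∫ x, mollify vol J φ x ∂μ + G h / 2 := by
  have hU := isSmoothHJSubsolution_mollify_hopfLax vol J hφ
  set U : ℝ → E → ℝ := fun t => mollify vol J (hopfLax φ t)
  set Φ := mollify vol J φ
  have hΦm : Measurable Φ := (contDiff_mollify vol J hφm hφ).continuous.measurable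
  have hΦ : ∀ x, |Φ x| ≤ K := abs_mollify_le vol J hφm hφ
  have hΨm : Measurable (mollify vol J ψ) := (contDiff_mollify vol J hψm hψ).continuous.measurable
  have hΨ : ∀ x, |mollify vol J ψ x| ≤ K := abs_mollify_le vol J hψm hψ
  have hρ := hGpos h hh
  have hfU : ∀ {X : E → ℝ}, Measurable X → (∀ x, |X x| ≤ K) →
      Integrable (fun x => f x * X x) μ := fun hX hK =>
    hfi.mul_bdd (c := K) hX.aestronglyMeasurable (ae_of_all _ hK)
  have h1 : ∫ x, f x * mollify vol J ψ x ∂μ ≤ ∫ x, f x * U (G h) x ∂μ := by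
    refine integral_mono (hfU hΨm hΨ) (hfU (hU.measurable hρ) (hU.abs_le _ hρ)) fun x => ?_
    refine mul_le_mul_of_nonneg_left ?_ (hf0 x)
    have := mollify_mono_add vol J hψm hψ (measurable_hopfLax hφ hρ) (abs_hopfLax_le hφ hρ)
      (a := 1) (b := 0) (x := x) (y := x) fun z => by
        rw [one_mul, add_zero]
        exact le_ciInf fun y => hψφ _ y
    simpa using this
  have h2 : ∀ a r, 0 < a → 0 < r → r ≤ h →
      ∫ x, f x * mollify vol J ψ x ∂μ ≤ (cgf Φ μ a + r) / a + G h / 2 := fun a r ha hr hrh => by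
    obtain ⟨s, has, hs⟩ := hLSI.exists_cgf_add_div_le hβmono hβ0 hU hGpos hG hGmono hr hrh ha
    have hs0 : 0 < s := ha.trans_le has
    have h3 := mul_integral_mul_le_cgf_add (hU.measurable hρ) (hU.abs_le _ hρ) hf0 hfi hf1 hfl s
    have h4 : ∫ x, f x * U (G h) x ∂μ ≤ (cgf (U (G h)) μ s + h) / s := by
      rw [le_div_iff₀ hs0]
      linarith
    have h5 : cgf (U (G r)) μ a ≤ cgf Φ μ a + a * 0 :=
      cgf_le_of_le_add (hU.measurable (hGpos r hr)) (hU.abs_le _ (hGpos r hr)) hΦm hΦ ha.le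
        fun x => by
          have := mollify_mono_add vol J (measurable_hopfLax hφ (hGpos r hr))
            (abs_hopfLax_le hφ (hGpos r hr)) hφm hφ
            (a := 1) (b := 0) (x := x) (y := x) fun z => by
              rw [one_mul, add_zero]
              exact hopfLax_le hφ (hGpos r hr) _
          simpa using this
    have h6 : (cgf (U (G r)) μ a + r) / a ≤ (cgf Φ μ a + r) / a :=
      div_le_div_of_nonneg_right (by linarith) ha.le
    linarith [hGpos r hr]
  have h3 : ∀ a, 0 < a → ∫ x, f x * mollify vol J ψ x ∂μ ≤ cgf Φ μ a / a + G h / 2 :=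
    fun a ha => by
      have hc : Tendsto (fun r => (cgf Φ μ a + r) / a + G h / 2) (𝓝[>] 0)
          (𝓝 ((cgf Φ μ a + 0) / a + G h / 2)) :=
        (((continuous_const.add continuous_id).div_const a).add_const _).continuousWithinAt
      rw [add_zero] at hc
      refine ge_of_tendsto hc ?_
      filter_upwards [Ioc_mem_nhdsGT hh] with r hr using h2 a r ha hr.1 hr.2
  have h4 : Tendsto (fun a => cgf Φ μ a / a + G h / 2) (𝓝[>] 0)
      (𝓝 (∫ x, Φ x ∂μ + G h / 2)) := by
    have hd := hasDerivAt_cgf_of_abs_le (μ := μ) hΦm hΦ 0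
    rw [deriv_cgf_zero (mem_interior_integrableExpSet_of_abs_le hΦm hΦ 0)] at hd
    simpa [div_eq_inv_mul] using hd.tendsto_slope_zero_right.add_const (G h / 2)
  refine ge_of_tendsto h4 ?_
  filter_upwards [self_mem_nhdsWithin] with a ha using h3 a ha

theorem SatisfiesLogSobolev.integral_sub_le [FiniteDimensional ℝ E]
    (hLSI : SatisfiesLogSobolev β μ) (hβmono : StrictMonoOn β (Set.Ici 0)) (hβ0 : β 0 = 0)
    {G : ℝ → ℝ} (hGpos : ∀ r, 0 < r → 0 < G r)
    (hG : ∀ r, 0 < r → HasDerivAt G (1 / (2 * √(β r))) r)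
    (hGmono : StrictMonoOn G (Set.Ioi 0)) {f φ ψ : E → ℝ} {h K : ℝ} (hh : 0 < h)
    (hf0 : ∀ x, 0 ≤ f x) (hfi : Integrable f μ) (hf1 : ∫ x, f x ∂μ = 1)
    (hfl : Integrable (fun x => f x * Real.log (f x)) μ)
    (hfh : ∫ x, f x * Real.log (f x) ∂μ ≤ h) (hφc : Continuous φ) (hφ : ∀ x, |φ x| ≤ K)
    (hψc : Continuous ψ) (hψ : ∀ x, |ψ x| ≤ K)
    (hψφ : ∀ x y, ψ x ≤ φ y + ‖x - y‖ ^ 2 / (2 * G h)) :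
    ∫ x, f x * ψ x ∂μ ≤ ∫ x, φ x ∂μ + G h / 2 := by
  let J : ℕ → ContDiffBump (0 : E) := fun n =>
    { rIn := 1 / ((n : ℝ) + 1) / 2
      rOut := 1 / ((n : ℝ) + 1)
      rIn_pos := by positivity
      rIn_lt_rOut := half_lt_self (by positivity) }
  have hJ : Tendsto (fun n => (J n).rOut) atTop (𝓝 0) := tendsto_one_div_add_atTop_nhds_zero_nat
  have h1 := tendsto_integral_mul_mollify Measure.addHaar hJ hfi hψc hψ
  have h2 := tendsto_integral_mul_mollify Measure.addHaar hJ (integrable_const (μ := μ) (1 : ℝ))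
    hφc hφ
  simp only [one_mul] at h2
  exact le_of_tendsto_of_tendsto' h1 (h2.add_const _) fun n =>
    hLSI.integral_mollify_le hβmono hβ0 hGpos hG hGmono hh hf0 hfi hf1 hfl hfh hφc.measurable hφ
      hψc.measurable hψ hψφ _ (J n)

theorem SatisfiesLogSobolev.wassersteinDist_le {n : ℕ} {μ : Measure (EuclideanSpace ℝ (Fin n))}
    [IsProbabilityMeasure μ]
    (hLSI : SatisfiesLogSobolev β μ) (hβmono : StrictMonoOn β (Set.Ici 0)) (hβ0 : β 0 = 0)
    {G : ℝ → ℝ} (hGpos : ∀ r, 0 < r → 0 < G r)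
    (hG : ∀ r, 0 < r → HasDerivAt G (1 / (2 * √(β r))) r)
    (hGmono : StrictMonoOn G (Set.Ioi 0)) {f : EuclideanSpace ℝ (Fin n) → ℝ} {h : ℝ} (hh : 0 < h)
    (hfm : Measurable f) (hf0 : ∀ x, 0 ≤ f x) (hfi : Integrable f μ) (hf1 : ∫ x, f x ∂μ = 1)
    (hfl : Integrable (fun x => f x * Real.log (f x)) μ)
    (hfh : ∫ x, f x * Real.log (f x) ∂μ ≤ h) :
    wassersteinDist 2 (μ.withDensity fun x => ENNReal.ofReal (f x)) μ ≤ ENNReal.ofReal (G h) := by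
  have hρ := hGpos h hh
  have hν : IsProbabilityMeasure (μ.withDensity fun x => ENNReal.ofReal (f x)) := ⟨by
    rw [withDensity_apply _ MeasurableSet.univ, setLIntegral_univ,
      ← ofReal_integral_eq_lintegral_ofReal hfi (ae_of_all _ hf0), hf1, ENNReal.ofReal_one]⟩
  obtain ⟨π, hπ1, hπ2, hπ⟩ := exists_coupling_of_dual_bound
    (μ.withDensity fun x => ENNReal.ofReal (f x)) μ (fun q => ‖q.1 - q.2‖ ^ 2 / (2 * G h))
    (by fun_prop) (fun q => by positivity) (G h / 2) (fun φ ψ hφψ => by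
      have h1 := hLSI.integral_sub_le hβmono hβ0 hGpos hG hGmono hh hf0 hfi hf1 hfl hfh
        (φ := fun x => -ψ x) (ψ := φ) (K := max ‖φ‖ ‖ψ‖) ψ.continuous.neg
        (fun x => by
          rw [abs_neg]
          exact (ψ.norm_coe_le_norm x).trans (le_max_right _ _)) φ.continuous
        (fun x => (φ.norm_coe_le_norm x).trans (le_max_left _ _))
        (fun x y => by linarith [hφψ (x, y)])
      rw [integral_neg] at h1
      rw [integral_withDensity_eq_integral_toReal_smul (by fun_prop)
        (ae_of_all _ fun _ => ENNReal.ofReal_lt_top)]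
      simp only [ENNReal.toReal_ofReal (hf0 _), smul_eq_mul]
      linarith)
  have hcost : ∫⁻ q, edist q.1 q.2 ^ (2 : ℝ) ∂π ≤ ENNReal.ofReal (G h) ^ (2 : ℝ) := by
    calc ∫⁻ q, edist q.1 q.2 ^ (2 : ℝ) ∂π
        = ∫⁻ q, ENNReal.ofReal (2 * G h) * ENNReal.ofReal (‖q.1 - q.2‖ ^ 2 / (2 * G h)) ∂π := by
          refine lintegral_congr fun q => ?_
          rw [← ENNReal.ofReal_mul (by positivity), mul_div_cancel₀ _ (by positivity),
            edist_dist, dist_eq_norm, ENNReal.ofReal_pow (norm_nonneg _), ENNReal.rpow_ofNat]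
      _ ≤ ENNReal.ofReal (2 * G h) * ENNReal.ofReal (G h / 2) := by
          rw [lintegral_const_mul' _ _ ENNReal.ofReal_ne_top]
          exact mul_le_mul_right hπ _
      _ = ENNReal.ofReal (G h) ^ (2 : ℝ) := by
          rw [← ENNReal.ofReal_mul (by positivity), ENNReal.rpow_ofNat,
            ← ENNReal.ofReal_pow hρ.le]
          congr 1
          ring
  calc wassersteinDist 2 (μ.withDensity fun x => ENNReal.ofReal (f x)) μ
      ≤ (ENNReal.ofReal (G h) ^ (2 : ℝ)) ^ (1 / (2 : ℝ)) :=
        ENNReal.rpow_le_rpow ((iInf₂_le π ⟨hπ1, hπ2⟩).trans hcost) (by norm_num)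
    _ = ENNReal.ofReal (G h) := by
        rw [← ENNReal.rpow_mul]
        norm_num

end Entropy

/-- **Transportation-entropy inequality (4.3)**: the `β`-log-Sobolev inequality
implies `W₂(fμ, μ) ≤ γ(μ(f log f))` for every probability density `f`,
where `γ(r) = ½∫₀^r ds/√β(s)`. -/
theorem beta_logSobolev_implies_W2H_gamma {n : ℕ}
    (V : EuclideanSpace ℝ (Fin n) → ℝ) (hV : Continuous V) (Z : ℝ) (hZ : 0 < Z)
    (μ : Measure (EuclideanSpace ℝ (Fin n)))
    (hμ : μ = volume.withDensity fun x => ENNReal.ofReal (Real.exp (-V x) / Z))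
    (hμprob : IsProbabilityMeasure μ)
    (β : ℝ → ℝ) (hβcont : ContinuousOn β (Set.Ici 0))
    (hβmono : StrictMonoOn β (Set.Ici 0)) (hβ0 : β 0 = 0)
    (hγfin : ∀ r : ℝ, 0 < r →
      IntervalIntegrable (fun s => 1 / Real.sqrt (β s)) volume 0 r)
    (hLSI : ∀ g : EuclideanSpace ℝ (Fin n) → ℝ, ContDiff ℝ 1 g →
      (∃ M, ∀ x, |g x| ≤ M) → (∫ x, g x ^ 2 ∂μ) = 1 →
      ENNReal.ofReal (β (∫ x, g x ^ 2 * Real.log (g x ^ 2) ∂μ)) ≤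
        ∫⁻ x, (‖gradient g x‖₊ : ℝ≥0∞) ^ 2 ∂μ) :
    ∀ f : EuclideanSpace ℝ (Fin n) → ℝ, Measurable f → (∀ x, 0 ≤ f x) →
      Integrable f μ → (∫ x, f x ∂μ) = 1 →
      Integrable (fun x => f x * Real.log (f x)) μ →
      wassersteinDist 2 (μ.withDensity fun x => ENNReal.ofReal (f x)) μ ≤
        ENNReal.ofReal ((1 / 2) *
          ∫ s in (0:ℝ)..(∫ x, f x * Real.log (f x) ∂μ), 1 / Real.sqrt (β s)) := by
  intro f hfm hf0 hfi hf1 hfl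
  set h := ∫ x, f x * Real.log (f x) ∂μ
  set G : ℝ → ℝ := fun r => 1 / 2 * ∫ s in (0 : ℝ)..r, 1 / √(β s)
  have hh0 : 0 ≤ h := by
    simpa using mul_integral_mul_le_cgf_add (μ := μ) (X := fun _ => 0) (K := 0) measurable_const
      (by simp) hf0 hfi hf1 hfl 0
  have hβpos : ∀ r, 0 < r → 0 < √(β r) := fun r hr =>
    Real.sqrt_pos.2 (hβ0 ▸ hβmono Set.self_mem_Ici hr.le hr)
  have hcont : ContinuousOn (fun s => 1 / √(β s)) (Set.Ioi 0) :=
    continuousOn_const.div (hβcont.mono Set.Ioi_subset_Ici_self).sqrt fun s hs => (hβpos s hs).ne'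
  have hGderiv : ∀ r, 0 < r → HasDerivAt G (1 / (2 * √(β r))) r := fun r hr => by
    have := (intervalIntegral.integral_hasDerivAt_right (hγfin r hr)
      (hcont.stronglyMeasurableAtFilter isOpen_Ioi r hr)
      (hcont.continuousAt (Ioi_mem_nhds hr))).const_mul (1 / 2)
    rwa [one_div_mul_one_div] at this
  have hGpos : ∀ r, 0 < r → 0 < G r := fun r hr =>
    mul_pos one_half_pos (intervalIntegral.intervalIntegral_pos_of_pos_on (hγfin r hr)
      (fun s hs => one_div_pos.2 (hβpos s hs.1)) hr)
  have hGmono : StrictMonoOn G (Set.Ioi 0) :=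
    strictMonoOn_of_deriv_pos (convex_Ioi 0)
      (fun r hr => (hGderiv r hr).continuousAt.continuousWithinAt) fun r hr => by
        rw [interior_Ioi] at hr
        rw [(hGderiv r hr).deriv]
        have := hβpos r hr
        positivity
  have hlim : Filter.Tendsto (fun r => ENNReal.ofReal (G r)) (nhdsWithin h (Set.Ioi h))
      (nhds (ENNReal.ofReal (G h))) := by
    refine ENNReal.tendsto_ofReal (Filter.Tendsto.const_mul _ ?_)
    have h1 := intervalIntegral.continuousOn_primitive_interval'
      (hγfin (h + 1) (by linarith)) Set.left_mem_uIcc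
    rw [Set.uIcc_of_le (by linarith)] at h1
    refine (h1 h ⟨hh0, by linarith⟩).mono_left (nhdsWithin_le_of_mem ?_)
    filter_upwards [Ioc_mem_nhdsGT (lt_add_one h)] with r hr
    exact ⟨hh0.trans hr.1.le, hr.2⟩
  refine ge_of_tendsto hlim ?_
  filter_upwards [self_mem_nhdsWithin] with r hr
  exact SatisfiesLogSobolev.wassersteinDist_le hLSI hβmono hβ0 hGpos hGderiv hGmono
    (hh0.trans_lt hr) hfm hf0 hfi hf1 hfl (Set.mem_Ioi.1 hr).le
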